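/- Let V be a finite-dimensional complex inner product space and H₁, H₂ ⊆ V two subspaces. Then there exists an orthogonal direct sum decomposition V = ⊕ₖ Vₖ such that each Vₖ has dimension at most 2, and for j = 1, 2 one has H_j = ⊕ₖ (Vₖ ∩ H_j). -/

import Mathlib

theorem exists_small_block {V : Type*} [AddCommGroup V] [Module ℂ V]
    [FiniteDimensional ℂ V] (P Q : V →ₗ[ℂ] V) (hP : ∀ x, P (P x) = P x)
    (hQ : ∀ x, Q (Q x) = Q x) (U : Submodule ℂ V) (hU : U ≠ ⊥)
    (hPU : ∀ x ∈ U, P x ∈ U) (hQU : ∀ x ∈ U, Q x ∈ U) :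
    ∃ W : Submodule ℂ V, W ≤ U ∧ W ≠ ⊥ ∧ Module.finrank ℂ W ≤ 2 ∧
      (∀ x ∈ W, P x ∈ W) ∧ (∀ x ∈ W, Q x ∈ W) := by
  have hTU : ∀ x ∈ U, (P + Q - P ∘ₗ Q - Q ∘ₗ P) x ∈ U := fun x hx =>
    U.sub_mem (U.sub_mem (U.add_mem (hPU x hx) (hQU x hx)) (hPU _ (hQU x hx)))
      (hQU _ (hPU x hx))
  have : Nontrivial U := Submodule.nontrivial_iff_ne_bot.mpr hU
  obtain ⟨c, hc⟩ := Module.End.exists_eigenvalue ((P + Q - P ∘ₗ Q - Q ∘ₗ P).restrict hTU)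
  obtain ⟨u, hu⟩ := hc.exists_hasEigenvector
  have hu0 : (u : V) ≠ 0 := fun h => hu.2 (Subtype.ext h)
  have hue : P (u : V) + Q u - P (Q u) - Q (P u) = c • (u : V) := by
    have := congrArg Subtype.val hu.apply_eq_smul
    simpa using this
  have key : ∃ v ∈ U, v ≠ 0 ∧ ∃ m : ℂ, P v = m • v ∧
      P v + Q v - P (Q v) - Q (P v) = c • v := by
    by_cases h : P (u : V) = 0
    · exact ⟨u, u.2, hu0, 0, by simp [h], hue⟩
    · refine ⟨P u, hPU _ u.2, h, 1, by simp [hP], ?_⟩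
      have := congrArg P hue
      simp only [map_sub, map_add, hP, map_smul] at this
      rw [← this, hP]
      abel
  obtain ⟨v, hvU, hv0, m, hm, hv⟩ := key
  have h1 : v ∈ Submodule.span ℂ {v, Q v} := Submodule.subset_span (by simp)
  have h2 : Q v ∈ Submodule.span ℂ {v, Q v} := Submodule.subset_span (by simp)
  refine ⟨Submodule.span ℂ {v, Q v}, ?_, ?_, ?_, ?_, ?_⟩
  · rw [Submodule.span_le]
    rintro x (rfl | rfl)
    · exact hvU
    · exact hQU _ hvU
  · intro h
    rw [h] at h1
    exact hv0 (by simpa using h1)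
  · classical
    have := finrank_span_finset_le_card (R := ℂ) ({v, Q v} : Finset V)
    have h3 := Finset.card_le_two (a := v) (b := Q v)
    have h4 : (({v, Q v} : Finset V) : Set V) = {v, Q v} := by simp
    rw [h4] at this
    exact le_trans this h3
  · have : Submodule.span ℂ {v, Q v} ≤ (Submodule.span ℂ {v, Q v}).comap P := by
      rw [Submodule.span_le]
      rintro x (rfl | rfl)
      · simp only [Submodule.comap_coe, Set.mem_preimage, SetLike.mem_coe, hm]
        exact Submodule.smul_mem _ _ h1
      · simp only [Submodule.comap_coe, Set.mem_preimage, SetLike.mem_coe]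
        have : P (Q v) = m • v + Q v - m • Q v - c • v := by
          rw [← hv, hm, map_smul]; abel
        rw [this]
        exact Submodule.sub_mem _ (Submodule.sub_mem _ (Submodule.add_mem _
          (Submodule.smul_mem _ _ h1) h2) (Submodule.smul_mem _ _ h2))
          (Submodule.smul_mem _ _ h1)
    exact fun x hx => this hx
  · have : Submodule.span ℂ {v, Q v} ≤ (Submodule.span ℂ {v, Q v}).comap Q := by
      rw [Submodule.span_le]
      rintro x (rfl | rfl)
      · exact h2
      · simp only [Submodule.comap_coe, Set.mem_preimage, SetLike.mem_coe, hQ]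
        exact h2
    exact fun x hx => this hx

theorem exists_blocks {V : Type*} [NormedAddCommGroup V] [InnerProductSpace ℂ V]
    [FiniteDimensional ℂ V] (P Q : V →ₗ[ℂ] V) (hP : ∀ x, P (P x) = P x)
    (hQ : ∀ x, Q (Q x) = Q x) (hPs : P.IsSymmetric) (hQs : Q.IsSymmetric) (d : ℕ) :
    ∀ U : Submodule ℂ V, Module.finrank ℂ U ≤ d →
    (∀ x ∈ U, P x ∈ U) → (∀ x ∈ U, Q x ∈ U) →
    ∃ (n : ℕ) (W : Fin n → Submodule ℂ V),
      (∀ i j, i ≠ j → W i ≤ (W j)ᗮ) ∧ (∀ i, W i ≤ U) ∧ U ≤ (⨆ i, W i) ∧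
      (∀ i, Module.finrank ℂ (W i) ≤ 2) ∧
      (∀ i, ∀ x ∈ W i, P x ∈ W i) ∧ (∀ i, ∀ x ∈ W i, Q x ∈ W i) := by
  induction d with
  | zero =>
    intro U hd _ _
    have : U = ⊥ := Submodule.finrank_eq_zero.mp (by omega)
    exact ⟨0, fun _ => ⊥, by simp, by simp, by simp [this], by simp, by simp, by simp⟩
  | succ d ih =>
    intro U hd hPU hQU
    by_cases hU : U = ⊥
    · exact ⟨0, fun _ => ⊥, by simp, by simp, by simp [hU], by simp, by simp, by simp⟩
    obtain ⟨W, hWU, hW0, hW2, hPW, hQW⟩ := exists_small_block P Q hP hQ U hU hPU hQU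
    have hlt : U ⊓ Wᗮ < U := by
      refine lt_of_le_of_ne inf_le_left fun h => hW0 ?_
      have h1 : W ≤ Wᗮ := hWU.trans (inf_eq_left.mp h)
      rw [← le_bot_iff, ← W.inf_orthogonal_eq_bot]
      exact le_inf le_rfl h1
    have hr := Submodule.finrank_lt_finrank_of_lt hlt
    have horth : ∀ R : V →ₗ[ℂ] V, R.IsSymmetric → (∀ x ∈ W, R x ∈ W) →
        ∀ x ∈ Wᗮ, R x ∈ Wᗮ := by
      intro R hR hRW x hx
      rw [Submodule.mem_orthogonal] at hx ⊢
      intro w hw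
      rw [← hR w x]
      exact hx _ (hRW w hw)
    obtain ⟨n, W', ho, hle, hsup, hdim, hp, hq⟩ := ih (U ⊓ Wᗮ) (by omega)
      (fun x hx => ⟨hPU x hx.1, horth P hPs hPW x hx.2⟩)
      (fun x hx => ⟨hQU x hx.1, horth Q hQs hQW x hx.2⟩)
    have hW' : ∀ i, W' i ≤ Wᗮ := fun i => (hle i).trans inf_le_right
    refine ⟨n + 1, Fin.cons W W', ?_, ?_, ?_, ?_, ?_, ?_⟩
    · intro i j hij
      induction i using Fin.cases with
      | zero =>
        induction j using Fin.cases with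
        | zero => exact absurd rfl hij
        | succ j =>
          simpa using (Submodule.le_orthogonal_orthogonal W).trans
            (Submodule.orthogonal_le (hW' j))
      | succ i =>
        induction j using Fin.cases with
        | zero => simpa using hW' i
        | succ j => simpa using ho i j (fun h => hij (by rw [h]))
    · exact Fin.cases hWU fun i => (hle i).trans inf_le_left
    · have h0 : W ≤ ⨆ i, (Fin.cons W W' : Fin (n + 1) → Submodule ℂ V) i :=
        le_iSup (Fin.cons W W' : Fin (n + 1) → Submodule ℂ V) 0
      have h1 : (⨆ i, W' i) ≤ ⨆ i, (Fin.cons W W' : Fin (n + 1) → Submodule ℂ V) i :=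
        iSup_le fun i => le_iSup (Fin.cons W W' : Fin (n + 1) → Submodule ℂ V) i.succ
      intro x hx
      obtain ⟨y, hy, z, hz, rfl⟩ := W.exists_add_mem_mem_orthogonal x
      refine Submodule.add_mem _ (h0 hy) (h1 (hsup ⟨?_, hz⟩))
      simpa using U.sub_mem hx (hWU hy)
    · exact Fin.cases hW2 hdim
    · exact Fin.cases hPW hp
    · exact Fin.cases hQW hq

theorem eq_iSup_inf {V : Type*} [NormedAddCommGroup V] [InnerProductSpace ℂ V]
    [FiniteDimensional ℂ V] (H : Submodule ℂ V) {n : ℕ} (W : Fin n → Submodule ℂ V)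
    (hW : ⊤ ≤ ⨆ i, W i)
    (h : ∀ i, ∀ x ∈ W i, (H.starProjection : V →ₗ[ℂ] V) x ∈ W i) :
    H = ⨆ i, (W i ⊓ H) := by
  apply le_antisymm
  · intro x hx
    have h1 : (⨆ i, W i) ≤ (⨆ i, (W i ⊓ H)).comap (H.starProjection : V →ₗ[ℂ] V) := by
      refine iSup_le fun i y hy => ?_
      exact Submodule.mem_iSup_of_mem i ⟨h i y hy, H.starProjection_apply_mem y⟩
    have h2 := h1 (hW (Submodule.mem_top (x := x)))
    simpa [Submodule.starProjection_eq_self_iff.mpr hx] using h2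
  · exact iSup_le fun i => inf_le_right

theorem statement1 {V : Type*} [NormedAddCommGroup V] [InnerProductSpace ℂ V]
    [FiniteDimensional ℂ V] (H₁ H₂ : Submodule ℂ V) :
    ∃ (n : ℕ) (W : Fin n → Submodule ℂ V),
      (∀ i j, i ≠ j → W i ≤ (W j)ᗮ) ∧
      (⨆ i, W i) = ⊤ ∧
      (∀ i, Module.finrank ℂ (W i) ≤ 2) ∧
      H₁ = ⨆ i, (W i ⊓ H₁) ∧
      H₂ = ⨆ i, (W i ⊓ H₂) := by
  obtain ⟨n, W, ho, -, hsup, hdim, hp, hq⟩ := exists_blocks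
    (H₁.starProjection : V →ₗ[ℂ] V) (H₂.starProjection : V →ₗ[ℂ] V)
    (fun x => Submodule.starProjection_eq_self_iff.mpr (H₁.starProjection_apply_mem x))
    (fun x => Submodule.starProjection_eq_self_iff.mpr (H₂.starProjection_apply_mem x))
    H₁.starProjection_isSymmetric H₂.starProjection_isSymmetric
    _ ⊤ le_rfl (by simp) (by simp)
  exact ⟨n, W, ho, top_le_iff.mp hsup, hdim, eq_iSup_inf H₁ W hsup hp,
    eq_iSup_inf H₂ W hsup hq⟩
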